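/- Let Γ be a finite directed graph and F a field. If Γ contains two distinct cycles having a common vertex, then the Leavitt path algebra L(Γ) has exponential growth: for every finite-dimensional generating subspace W of L(Γ) there exist constants c > 1 and N such that dim_F (W + W² + ⋯ + Wⁿ) ≥ cⁿ for all n ≥ N. -/

import Mathlib

open scoped BigOperators

section LeavittSetup

variable {V E : Type}

/-- Generators of the Leavitt path algebra of a graph: vertices, edges, and ghost (star) edges. -/
inductive LGen (V E : Type) : Type
  | vert : V → LGen V E
  | edge : E → LGen V E
  | star : E → LGen V E

variable (F : Type) [Field F]

/-- The vertex generator inside the free algebra. -/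
noncomputable def gvert (v : V) : FreeAlgebra F (LGen V E) := FreeAlgebra.ι F (LGen.vert v)

/-- The edge generator inside the free algebra. -/
noncomputable def gedge (e : E) : FreeAlgebra F (LGen V E) := FreeAlgebra.ι F (LGen.edge e)

/-- The ghost edge generator `e*` inside the free algebra. -/
noncomputable def gstar (e : E) : FreeAlgebra F (LGen V E) := FreeAlgebra.ι F (LGen.star e)

variable (s r : E → V)

/-- The defining relations of the Leavitt path algebra of the graph `(V, E, s, r)`:
(1) `v * w = δ_{v,w} v`; (2) `s(e) e = e = e r(e)` and `r(e) e* = e* = e* s(e)`;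
(3) `e* f = δ_{e,f} r(e)`; (4) `v = ∑_{s(e) = v} e e*` for every non-sink `v`
(the sum makes sense whenever `v` emits finitely many edges, in particular for a
row-finite graph). -/
inductive LeavittRel : FreeAlgebra F (LGen V E) → FreeAlgebra F (LGen V E) → Prop
  | vertSelf (v : V) : LeavittRel (gvert F v * gvert F v) (gvert F v)
  | vertNe {v w : V} (h : v ≠ w) : LeavittRel (gvert F v * gvert F w) 0
  | edgeSource (e : E) : LeavittRel (gvert F (s e) * gedge F e) (gedge F e)
  | edgeRange (e : E) : LeavittRel (gedge F e * gvert F (r e)) (gedge F e)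
  | starRange (e : E) : LeavittRel (gvert F (r e) * gstar F e) (gstar F e)
  | starSource (e : E) : LeavittRel (gstar F e * gvert F (s e)) (gstar F e)
  | starEdgeSelf (e : E) : LeavittRel (gstar F e * gedge F e) (gvert F (r e))
  | starEdgeNe {e f : E} (h : e ≠ f) : LeavittRel (gstar F e * gedge F f) 0
  | ck (v : V) (h : {e : E | s e = v}.Finite) (hne : ∃ e, s e = v) :
      LeavittRel (gvert F v) (∑ e ∈ h.toFinset, gedge F e * gstar F e)

/-- The Leavitt path algebra `L(Γ)` of the graph `Γ = (V, E, s, r)` over the field `F`,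
presented as the quotient of the free algebra on the generators by the Leavitt relations. -/
noncomputable abbrev LeavittPathAlgebra := RingQuot (LeavittRel F s r)

/-- The image of a vertex in the Leavitt path algebra. -/
noncomputable def lvert (v : V) : LeavittPathAlgebra F s r :=
  RingQuot.mkAlgHom F (LeavittRel F s r) (gvert F v)

/-- The image of an edge in the Leavitt path algebra. -/
noncomputable def ledge (e : E) : LeavittPathAlgebra F s r :=
  RingQuot.mkAlgHom F (LeavittRel F s r) (gedge F e)

/-- The image of a ghost edge `e*` in the Leavitt path algebra. -/
noncomputable def lstar (e : E) : LeavittPathAlgebra F s r :=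
  RingQuot.mkAlgHom F (LeavittRel F s r) (gstar F e)

/-- The element of the Leavitt path algebra given by a path `p = e₁ ⋯ eₙ` (a list of edges). -/
noncomputable def lpath (p : List E) : LeavittPathAlgebra F s r := (p.map (ledge F s r)).prod

/-- The element `p* = eₙ* ⋯ e₁*` of the Leavitt path algebra given by a path `p = e₁ ⋯ eₙ`. -/
noncomputable def lpathStar (p : List E) : LeavittPathAlgebra F s r :=
  (p.reverse.map (lstar F s r)).prod

/-- A list of edges is a path when the range of each edge is the source of the next. -/
def IsPath (s r : E → V) (p : List E) : Prop := List.Chain' (fun e f => r e = s f) p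

/-- A nonempty path starts at the source of its first edge. -/
def StartsAt (s : E → V) (p : List E) (v : V) : Prop := ∃ e, p.head? = some e ∧ s e = v

/-- A nonempty path ends at the range of its last edge. -/
def EndsAt (r : E → V) (p : List E) (v : V) : Prop := ∃ e, p.getLast? = some e ∧ r e = v

/-- A (nonempty) closed path: it starts and ends at the same vertex. -/
def IsClosedPath (s r : E → V) (p : List E) : Prop := ∃ v, StartsAt s p v ∧ EndsAt r p v

/-- A cycle: a closed path whose source vertices are pairwise distinct.  A cycle is
identified with the subgraph it spans, i.e. with its set of edges `{e | e ∈ p}`. -/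
def IsCycle (s r : E → V) (p : List E) : Prop :=
  IsPath s r p ∧ IsClosedPath s r p ∧ (p.map s).Nodup

/-- The vertex set `V(C)` of a cycle (the sources of its edges). -/
def cycleVerts (s : E → V) (c : List E) : Set V := {v | ∃ e ∈ c, s e = v}

/-- `C ⟹ C'`: some (possibly empty) path starts at a vertex of `C` and ends at a
vertex of `C'`. -/
def CycleConnects (s r : E → V) (c c' : List E) : Prop :=
  ∃ v w, v ∈ cycleVerts s c ∧ w ∈ cycleVerts s c' ∧
    (v = w ∨ ∃ p, p ≠ [] ∧ IsPath s r p ∧ StartsAt s p v ∧ EndsAt r p w)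

/-- A chain of cycles `C₁ ⟹ C₂ ⟹ ⋯ ⟹ C_k`: pairwise distinct cycles, each connected
to the next; its length is the number of cycles. -/
def IsChainOfCycles (s r : E → V) (cs : List (List E)) : Prop :=
  (∀ c ∈ cs, IsCycle s r c) ∧ List.Chain' (CycleConnects s r) cs ∧
    List.Pairwise (fun c c' => {e | e ∈ c} ≠ {e | e ∈ c'}) cs

/-- A cycle has an exit if some edge starts at a vertex of the cycle but is not an
edge of the cycle. -/
def HasExit (s : E → V) (c : List E) : Prop := ∃ e, s e ∈ cycleVerts s c ∧ e ∉ c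

/-- A chain of cycles with an exit: the last cycle of the chain has an exit. -/
def ChainWithExit (s r : E → V) (cs : List (List E)) : Prop :=
  IsChainOfCycles s r cs ∧ ∃ c, cs.getLast? = some c ∧ HasExit s c

/-- Any two distinct cycles of the graph have no common vertex: two cycles sharing a
vertex coincide (have the same edge set). -/
def SeparatedCycles (s r : E → V) : Prop :=
  ∀ c c', IsCycle s r c → IsCycle s r c' →
    (cycleVerts s c ∩ cycleVerts s c').Nonempty → {e | e ∈ c} = {e | e ∈ c'}

/-- `W + W² + ⋯ + Wⁿ` for a subspace `W` of an `F`-algebra. -/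
noncomputable def powsSum {A : Type} [Semiring A] [Algebra F A]
    (W : Submodule F A) (n : ℕ) : Submodule F A :=
  ∑ i ∈ Finset.Icc 1 n, W ^ i


/-! ### Abstract growth lemma -/

section Abstract

variable {A : Type} [Ring A] [Algebra F A]

/-- Word in `x` ending with `v`. -/
def wordX (x : Bool → A) (v : A) : List Bool → A
  | [] => v
  | i :: w => x i * wordX x v w

/-- Dual word. -/
def wordY (y : Bool → A) : List Bool → A
  | [] => 1
  | i :: w => wordY y w * y i

theorem wordX_left (x : Bool → A) (v : A) (hvv : v * v = v) (hvx : ∀ i, v * x i = x i)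
    (w : List Bool) : v * wordX x v w = wordX x v w := by
  cases w with
  | nil => exact hvv
  | cons i w => simp only [wordX]; rw [← mul_assoc, hvx]

theorem wordY_mul_wordX (x y : Bool → A) (v : A) (hvv : v * v = v) (hvx : ∀ i, v * x i = x i)
    (hyx : ∀ i j, y i * x j = if i = j then v else 0) :
    ∀ w w' : List Bool, w.length = w'.length →
      wordY y w * wordX x v w' = if w = w' then v else 0
  | [], [], _ => by simp [wordX, wordY]
  | [], _ :: _, h => by simp at h
  | _ :: _, [], h => by simp at h
  | i :: w, j :: w', h => by
    have ih := wordY_mul_wordX x y v hvv hvx hyx w w' (by simpa using h)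
    have e : wordY y (i :: w) * wordX x v (j :: w')
        = wordY y w * ((y i * x j) * wordX x v w') := by
      simp only [wordX, wordY, mul_assoc]
    rw [e, hyx]
    by_cases hij : i = j
    · simp only [hij, if_true]
      rw [wordX_left x v hvv hvx, ih]
      simp
    · simp [hij]

theorem wordX_linearIndependent (x y : Bool → A) (v : A) (hv : v ≠ 0) (hvv : v * v = v)
    (hvx : ∀ i, v * x i = x i)
    (hyx : ∀ i j, y i * x j = if i = j then v else 0) (k : ℕ) :
    LinearIndependent F (fun w : List.Vector Bool k => wordX x v w.toList) := by
  classical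
  rw [Fintype.linearIndependent_iff]
  intro g hg u
  have h := congrArg (fun z => wordY y u.toList * z) hg
  simp only [Finset.mul_sum, mul_zero, mul_smul_comm] at h
  rw [Finset.sum_eq_single u] at h
  · rw [wordY_mul_wordX x y v hvv hvx hyx _ _ rfl] at h
    simpa [hv] using h
  · intro b _ hb
    rw [wordY_mul_wordX x y v hvv hvx hyx _ _ (by simp), if_neg, smul_zero]
    intro h'
    exact hb (List.Vector.toList_injective h').symm
  · simp

theorem powsSum_mono (W : Submodule F A) {m n : ℕ} (h : m ≤ n) :
    powsSum F W m ≤ powsSum F W n := by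
  unfold powsSum
  rw [← Finset.sum_subset_zero_on_sdiff (s₁ := Finset.Icc 1 m) (s₂ := Finset.Icc 1 m)
    (f := fun i => W ^ i) (g := fun i => W ^ i) (fun _ h => h) (by simp) (by simp)]
  exact Finset.sum_le_sum_of_subset (Finset.Icc_subset_Icc le_rfl h)

theorem powsSum_mul (W : Submodule F A) (m n : ℕ) :
    powsSum F W m * powsSum F W n ≤ powsSum F W (m + n) := by
  unfold powsSum
  rw [Finset.sum_mul_sum]
  have key : ∀ (S : Finset ℕ) (f : ℕ → Submodule F A) (T : Submodule F A),
      (∀ i ∈ S, f i ≤ T) → ∑ i ∈ S, f i ≤ T := by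
    intro S f T
    induction S using Finset.induction_on with
    | empty => intro _; simp
    | insert a S ha ih =>
      intro h
      rw [Finset.sum_insert ha, Submodule.add_eq_sup]
      exact sup_le (h _ (by simp)) (ih fun i hi => h i (by simp [hi]))
  refine key _ _ _ fun i hi => key _ _ _ fun j hj => ?_
  rw [← pow_add]
  rw [Finset.mem_Icc] at hi hj
  exact Finset.single_le_sum (f := fun i => W ^ i) (fun _ _ => bot_le)
    (Finset.mem_Icc.mpr ⟨by omega, by omega⟩)

theorem powsSum_fg (W : Submodule F A) (hW : W.FG) (n : ℕ) : (powsSum F W n).FG := by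
  unfold powsSum
  induction Finset.Icc 1 n using Finset.induction_on with
  | empty => simpa using Submodule.fg_bot
  | insert a S ha ih =>
    rw [Finset.sum_insert ha, Submodule.add_eq_sup]
    exact (hW.pow a).sup ih

theorem wordX_mem (W : Submodule F A) (x : Bool → A) (v : A) (m : ℕ)
    (hx : ∀ i, x i ∈ powsSum F W m) (hv : v ∈ powsSum F W m) :
    ∀ w : List Bool, wordX x v w ∈ powsSum F W (m * (w.length + 1))
  | [] => by simpa [wordX] using hv
  | i :: w => by
    have h := powsSum_mul F W m (m * (w.length + 1))
      (Submodule.mul_mem_mul (hx i) (wordX_mem W x v m hx hv w))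
    have e : m * ((i :: w).length + 1) = m + m * (w.length + 1) := by
      simp only [List.length_cons]; ring
    rw [e]; exact h

theorem abstract_growth (W : Submodule F A) (hfd : FiniteDimensional F W)
    (hgen : ∀ x : A, ∃ n : ℕ, x ∈ powsSum F W n)
    (x y : Bool → A) (v : A) (hv : v ≠ 0) (hvv : v * v = v)
    (hvx : ∀ i, v * x i = x i)
    (hyx : ∀ i j, y i * x j = if i = j then v else 0) :
    ∃ c : ℝ, 1 < c ∧ ∃ N : ℕ, ∀ n ≥ N,
      c ^ n ≤ (Module.finrank F (powsSum F W n) : ℝ) := by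
  obtain ⟨a, ha⟩ := hgen v
  obtain ⟨b, hb⟩ := hgen (x true)
  obtain ⟨d, hd⟩ := hgen (x false)
  obtain ⟨m, hm⟩ : ∃ m, m = a + b + d + 1 := ⟨_, rfl⟩
  have hvm : v ∈ powsSum F W m := powsSum_mono F W (by omega) ha
  have hxm : ∀ i, x i ∈ powsSum F W m := by
    intro i
    cases i
    · exact powsSum_mono F W (by omega) hd
    · exact powsSum_mono F W (by omega) hb
  have hm0 : 0 < m := by omega
  have hW : W.FG := Module.Finite.iff_fg.mp hfd
  have dimb : ∀ k n, m * (k + 1) ≤ n → 2 ^ k ≤ Module.finrank F (powsSum F W n) := by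
    intro k n hkn
    have : Module.Finite F (powsSum F W n) := Module.Finite.iff_fg.mpr (powsSum_fg F W hW n)
    have hmem : ∀ w : List.Vector Bool k, wordX x v w.toList ∈ powsSum F W n := by
      intro w
      refine powsSum_mono F W ?_ (wordX_mem F W x v m hxm hvm w.toList)
      simpa using hkn
    have li := wordX_linearIndependent F x y v hv hvv hvx hyx k
    have li' : LinearIndependent F
        (fun w : List.Vector Bool k => (⟨wordX x v w.toList, hmem w⟩ : powsSum F W n)) :=
      LinearIndependent.of_comp (powsSum F W n).subtype li
    have := li'.fintype_card_le_finrank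
    simpa [card_vector] using this
  refine ⟨(2 : ℝ) ^ ((1 : ℝ) / (3 * m)), ?_, 3 * m, ?_⟩
  · apply Real.one_lt_rpow (by norm_num)
    positivity
  · intro n hn
    obtain ⟨q, hq⟩ : ∃ q, q = n / m := ⟨_, rfl⟩
    have h3 : 3 ≤ q := by rw [hq, Nat.le_div_iff_mul_le hm0]; exact hn
    obtain ⟨k, rfl⟩ : ∃ k, q = k + 1 := ⟨q - 1, by omega⟩
    have hle : m * (k + 1) ≤ n := by rw [hq]; exact Nat.mul_div_le n m
    have hlt : n < m * (k + 1 + 1) := by rw [hq]; exact Nat.lt_mul_div_succ n hm0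
    have h1 := dimb k n hle
    calc ((2 : ℝ) ^ ((1 : ℝ) / (3 * m))) ^ n = (2 : ℝ) ^ ((1 : ℝ) / (3 * m) * n) := by
          rw [Real.rpow_mul_natCast (by norm_num)]
      _ ≤ (2 : ℝ) ^ (k : ℝ) := by
          apply Real.rpow_le_rpow_of_exponent_le (by norm_num)
          have hm' : (0 : ℝ) < m := by exact_mod_cast hm0
          rw [one_div, inv_mul_le_iff₀ (by positivity)]
          have : n ≤ 3 * m * k := by nlinarith
          exact_mod_cast this
      _ = ((2 ^ k : ℕ) : ℝ) := by rw [Real.rpow_natCast]; push_cast; rfl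
      _ ≤ _ := by exact_mod_cast h1

end Abstract

/-! ### Nonvanishing of vertices -/

theorem exists_branching [Finite E] : ∃ (j : E → ℕ → ℕ) (k : E → ℕ → Option ℕ),
    (∀ e m, k e (j e m) = some m) ∧
    (∀ e f m, e ≠ f → s e = s f → k e (j f m) = none) ∧
    (∀ e n m, k e n = some m → n = j e m) ∧
    (∀ u n, (∃ e, s e = u) → ∃ e m, s e = u ∧ n = j e m) := by
  classical
  have H : ∀ u, ∃ j : {e // s e = u} × ℕ → ℕ, Function.Injective j ∧
      (Nonempty {e // s e = u} → Function.Surjective j) := by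
    intro u
    rcases isEmpty_or_nonempty {e // s e = u} with h | h
    · exact ⟨fun _ => 0, fun a => (h.false a.1).elim, fun h' => (h.false h'.some).elim⟩
    · obtain ⟨φ⟩ := nonempty_equiv_of_countable (α := {e // s e = u} × ℕ) (β := ℕ)
      exact ⟨φ, φ.injective, fun _ => φ.surjective⟩
  choose J hinj hsurj using H
  have Jeq : ∀ u e (h : s e = u) m, J u (⟨e, h⟩, m) = J (s e) (⟨e, rfl⟩, m) := by
    intro u e h m; subst h; rfl
  have jinj : ∀ e f m m', s e = s f →
      J (s e) (⟨e, rfl⟩, m) = J (s f) (⟨f, rfl⟩, m') → e = f ∧ m = m' := by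
    intro e f m m' h h'
    have : J (s f) (⟨e, h⟩, m) = J (s f) (⟨f, rfl⟩, m') := by
      rw [← h', Jeq]
    have := hinj _ this
    simpa using this
  refine ⟨fun e m => J (s e) (⟨e, rfl⟩, m),
    fun e => Function.partialInv fun m => J (s e) (⟨e, rfl⟩, m), ?_, ?_, ?_, ?_⟩
  · intro e m
    exact Function.partialInv_left (fun a b h => (jinj e e a b rfl h).2) m
  · intro e f m hne hs
    simp only [Function.partialInv]
    rw [dif_neg]
    rintro ⟨a, ha⟩
    exact hne (jinj e f _ _ hs ha).1
  · intro e n m h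
    exact ((Function.partialInv_of_injective (fun a b h => (jinj e e a b rfl h).2) m n).1 h).symm
  · rintro u n ⟨e, rfl⟩
    obtain ⟨⟨⟨f, hf⟩, m⟩, h⟩ := hsurj (s e) ⟨⟨e, rfl⟩⟩ n
    refine ⟨f, m, hf, ?_⟩
    rw [← h, Jeq]

theorem lvert_ne_zero [Finite E] (v : V) : lvert F s r v ≠ 0 := by
  classical
  obtain ⟨j, k, hkj, hkne, hk, hsur⟩ := exists_branching s
  let pv : V → Module.End F (V × ℕ →₀ F) := fun v => Finsupp.linearCombination F
    (fun x : V × ℕ => if x.1 = v then (Finsupp.single x 1 : V × ℕ →₀ F) else 0)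
  let pe : E → Module.End F (V × ℕ →₀ F) := fun e => Finsupp.linearCombination F
    (fun x : V × ℕ => if x.1 = r e then (Finsupp.single (s e, j e x.2) 1 : V × ℕ →₀ F) else 0)
  let ps : E → Module.End F (V × ℕ →₀ F) := fun e => Finsupp.linearCombination F
    (fun x : V × ℕ => if x.1 = s e then
      (k e x.2).elim (0 : V × ℕ →₀ F) (fun m => Finsupp.single (r e, m) 1) else 0)
  have hpv : ∀ v x, pv v (Finsupp.single x 1) = if x.1 = v then Finsupp.single x 1 else 0 := by
    intro v x; simp [pv]
  have hpe : ∀ e x, pe e (Finsupp.single x 1) =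
      if x.1 = r e then Finsupp.single (s e, j e x.2) 1 else 0 := by
    intro v x; simp [pe]
  have hps : ∀ e x, ps e (Finsupp.single x 1) = if x.1 = s e then
      (k e x.2).elim (0 : V × ℕ →₀ F) (fun m => Finsupp.single (r e, m) 1) else 0 := by
    intro v x; simp [ps]
  have hext : ∀ f g : Module.End F (V × ℕ →₀ F),
      (∀ u n, f (Finsupp.single (u, n) 1) = g (Finsupp.single (u, n) 1)) → f = g := by
    intro f g h
    apply Finsupp.lhom_ext'
    rintro ⟨u, n⟩
    ext1
    exact h u n
  clear_value pv pe ps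
  let gen : LGen V E → Module.End F (V × ℕ →₀ F) := fun g => match g with
    | .vert v => pv v
    | .edge e => pe e
    | .star e => ps e
  let φ := FreeAlgebra.lift F gen
  have φv : ∀ v, φ (gvert F v) = pv v := fun v => by simp [φ, gvert, gen]
  have φe : ∀ v, φ (gedge F v) = pe v := fun v => by simp [φ, gedge, gen]
  have φs : ∀ v, φ (gstar F v) = ps v := fun v => by simp [φ, gstar, gen]
  have hrel : ∀ ⦃x y⦄, LeavittRel F s r x y → φ x = φ y := by
    intro x y h
    induction h with
    | vertSelf v =>
      simp only [map_mul, φv]; apply hext; intro u n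
      by_cases h : u = v <;> simp [hpv, h]
    | vertNe h =>
      rename_i v w
      simp only [map_mul, φv, map_zero]; apply hext; intro u n
      by_cases h' : u = w
      · subst h'; simp [hpv, Ne.symm h]
      · simp [hpv, h']
    | edgeSource e =>
      simp only [map_mul, φv, φe]; apply hext; intro u n
      by_cases h : u = r e <;> simp [hpv, hpe, h]
    | edgeRange e =>
      simp only [map_mul, φv, φe]; apply hext; intro u n
      by_cases h : u = r e <;> simp [hpv, hpe, h]
    | starRange e =>
      simp only [map_mul, φv, φs]; apply hext; intro u n
      by_cases h : u = s e
      · cases h' : k e n <;> simp [hpv, hps, h, h']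
      · simp [hps, h]
    | starSource e =>
      simp only [map_mul, φv, φs]; apply hext; intro u n
      by_cases h : u = s e <;> simp [hpv, hps, h]
    | starEdgeSelf e =>
      simp only [map_mul, φv, φs, φe]; apply hext; intro u n
      by_cases h : u = r e <;> simp [hpv, hps, hpe, h, hkj]
    | starEdgeNe h =>
      rename_i e f
      simp only [map_mul, φs, φe, map_zero]; apply hext; intro u n
      by_cases h' : u = r f
      · by_cases h2 : s f = s e
        · simp [hps, hpe, h', h2, hkne e f n h h2.symm]
        · simp [hps, hpe, h', h2]
      · simp [hpe, h']
    | ck v hf hne =>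
      simp only [map_sum, map_mul, φv, φs, φe]; apply hext; intro u n
      rw [LinearMap.sum_apply]
      by_cases h : u = v
      · subst h
        obtain ⟨e, m, he, hn⟩ := hsur u n hne
        rw [Finset.sum_eq_single e]
        · subst hn
          simp [hpv, hps, hpe, he, hkj]
        · intro f hf' hfe
          have hsf : s f = u := by simpa using hf'
          have : k f n = none := by rw [hn]; exact hkne f e m hfe (by rw [hsf, he])
          simp [hps, hsf, this]
        · intro h'; exact absurd he (by simpa using h')
      · rw [Finset.sum_eq_zero]
        · simp [hpv, h]
        · intro f hf'
          have hsf : s f = v := by simpa using hf'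
          simp [hps, hsf, h]
  intro h0
  have h1 := congrArg (RingQuot.liftAlgHom F ⟨φ, hrel⟩) h0
  simp only [lvert, RingQuot.liftAlgHom_mkAlgHom_apply, map_zero] at h1
  rw [φv] at h1
  have h2 := congrArg (fun f : Module.End F (V × ℕ →₀ F) => f (Finsupp.single (v, 0) 1)) h1
  simp [hpv] at h2

/-! ### Relations in the Leavitt path algebra -/

theorem lvert_self (v : V) : lvert F s r v * lvert F s r v = lvert F s r v := by
  simp only [lvert, ← map_mul]
  exact RingQuot.mkAlgHom_rel F (.vertSelf v)

theorem lvert_ledge (e : E) : lvert F s r (s e) * ledge F s r e = ledge F s r e := by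
  simp only [lvert, ledge, ← map_mul]
  exact RingQuot.mkAlgHom_rel F (.edgeSource e)

theorem lstar_ledge_self (e : E) : lstar F s r e * ledge F s r e = lvert F s r (r e) := by
  simp only [lvert, ledge, lstar, ← map_mul]
  exact RingQuot.mkAlgHom_rel F (.starEdgeSelf e)

theorem lstar_ledge_ne {e f : E} (h : e ≠ f) : lstar F s r e * ledge F s r f = 0 := by
  simp only [ledge, lstar, ← map_mul]
  rw [RingQuot.mkAlgHom_rel F (LeavittRel.starEdgeNe h), map_zero]

theorem lpath_cons (e : E) (p : List E) :
    lpath F s r (e :: p) = ledge F s r e * lpath F s r p := by simp [lpath]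

theorem lpathStar_cons (e : E) (p : List E) :
    lpathStar F s r (e :: p) = lpathStar F s r p * lstar F s r e := by simp [lpathStar]

/-- Walks from `u` to `w`. -/
def WalkFT (s r : E → V) : V → List E → V → Prop
  | u, [], w => u = w
  | u, e :: p, w => s e = u ∧ WalkFT s r (r e) p w

theorem walk_append : ∀ (p q : List E) (u w : V),
    WalkFT s r u (p ++ q) w ↔ ∃ x, WalkFT s r u p x ∧ WalkFT s r x q w
  | [], q, u, w => by simp [WalkFT]
  | e :: p, q, u, w => by
    simp only [List.cons_append, WalkFT, walk_append p q]
    constructor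
    · rintro ⟨h, x, h1, h2⟩; exact ⟨x, ⟨h, h1⟩, h2⟩
    · rintro ⟨x, ⟨h, h1⟩, h2⟩; exact ⟨h, x, h1, h2⟩

theorem walk_unique : ∀ (p : List E) (u w w' : V),
    WalkFT s r u p w → WalkFT s r u p w' → w = w'
  | [], _, _, _, h, h' => h.symm.trans h'
  | _ :: p, _, _, _, h, h' => walk_unique p _ _ _ h.2 h'.2

theorem walk_of_path : ∀ (p : List E) (e : E), IsPath s r (e :: p) → ∀ w,
    EndsAt r (e :: p) w → WalkFT s r (s e) (e :: p) w
  | [], e, _, w, h => by simpa [EndsAt, WalkFT] using h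
  | f :: p, e, hp, w, h => by
    have hp' : r e = s f ∧ IsPath s r (f :: p) := by
      simpa [IsPath, List.Chain'] using hp
    have := walk_of_path p f hp'.2 w (by simpa [EndsAt] using h)
    refine ⟨rfl, ?_⟩
    rw [hp'.1]; exact this

theorem cycle_rotate (c : List E) (hc : IsCycle s r c) (v : V) (hv : v ∈ cycleVerts s c) :
    ∃ p : List E, p ≠ [] ∧ WalkFT s r v p v ∧ (p.map s).Nodup ∧ ∀ e, e ∈ p ↔ e ∈ c := by
  obtain ⟨hp, ⟨u, ⟨e0, he0, hu⟩, hend⟩, hnd⟩ := hc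
  obtain ⟨e, he, rfl⟩ := hv
  have hw : WalkFT s r u c u := by
    cases c with
    | nil => simp at he0
    | cons f c =>
      have hfe : f = e0 := by simpa using he0
      subst hfe; subst hu
      exact walk_of_path s r c f hp _ hend
  obtain ⟨a, b, rfl⟩ := List.append_of_mem he
  obtain ⟨x, h1, h2⟩ := (walk_append s r _ _ _ _).1 hw
  have hx : s e = x := h2.1
  subst hx
  refine ⟨e :: b ++ a, by simp, (walk_append s r _ _ _ _).2 ⟨u, h2, h1⟩, ?_, ?_⟩
  · rw [List.map_append] at hnd ⊢
    exact List.nodup_append_comm.1 hnd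
  · intro f; simp only [List.mem_append]; tauto

theorem no_prefix (p q : List E) (v : V) (hp0 : p ≠ []) (hp : WalkFT s r v p v)
    (hq : WalkFT s r v q v) (hnd : (q.map s).Nodup) (h : p <+: q) : p = q := by
  obtain ⟨t, rfl⟩ := h
  obtain ⟨x, h1, h2⟩ := (walk_append s r _ _ _ _).1 hq
  have hx := walk_unique s r p _ _ _ h1 hp
  subst hx
  cases t with
  | nil => simp
  | cons g t =>
    cases p with
    | nil => exact absurd rfl hp0
    | cons f p =>
      have e1 : s f = x := hp.1
      have e2 : s g = x := h2.1
      simp [e1, e2] at hnd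

theorem lvert_lpath (p : List E) (u w : V) (h : WalkFT s r u p w) :
    lvert F s r u * (lpath F s r p * lvert F s r w) = lpath F s r p * lvert F s r w := by
  cases p with
  | nil =>
    have : u = w := h
    subst this
    simp [lpath, lvert_self]
  | cons e p =>
    have : s e = u := h.1
    subst this
    rw [lpath_cons, ← mul_assoc, ← mul_assoc, lvert_ledge]

theorem lpathStar_self : ∀ (p : List E) (u w : V), WalkFT s r u p w →
    lpathStar F s r p * (lpath F s r p * lvert F s r w) = lvert F s r w
  | [], u, w, _ => by simp [lpath, lpathStar]
  | e :: p, u, w, h => by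
    rw [lpath_cons, lpathStar_cons]
    have : lpathStar F s r p * lstar F s r e * (ledge F s r e * lpath F s r p * lvert F s r w)
      = lpathStar F s r p * ((lstar F s r e * ledge F s r e) *
        (lpath F s r p * lvert F s r w)) := by simp only [mul_assoc]
    rw [this, lstar_ledge_self, lvert_lpath F s r p _ _ h.2, lpathStar_self p _ _ h.2]

theorem lpathStar_ne : ∀ (p q : List E) (u w w' : V), WalkFT s r u p w → WalkFT s r u q w' →
    ¬ p <+: q → ¬ q <+: p →
    lpathStar F s r p * (lpath F s r q * lvert F s r w') = 0
  | [], q, _, _, _, _, _, h, _ => absurd List.nil_prefix h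
  | _ :: _, [], _, _, _, _, _, _, h => absurd List.nil_prefix h
  | e :: p, f :: q, u, w, w', hp, hq, h1, h2 => by
    rw [lpath_cons, lpathStar_cons]
    have : lpathStar F s r p * lstar F s r e * (ledge F s r f * lpath F s r q * lvert F s r w')
      = lpathStar F s r p * ((lstar F s r e * ledge F s r f) *
        (lpath F s r q * lvert F s r w')) := by simp only [mul_assoc]
    rw [this]
    by_cases hef : e = f
    · subst hef
      rw [lstar_ledge_self, lvert_lpath F s r q _ _ hq.2]
      exact lpathStar_ne p q _ _ _ hp.2 hq.2 (by simpa using h1) (by simpa using h2)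
    · rw [lstar_ledge_ne F s r hef]; simp

/-- Corollary 1 of the paper.  If a finite graph `Γ` has two distinct
cycles with a common vertex, then `L(Γ)` has exponential growth: for every
finite-dimensional generating subspace `W` there are `c > 1` and `N` such that
`dim_F (W + W² + ⋯ + Wⁿ) ≥ cⁿ` for all `n ≥ N`. -/
theorem exponential_growth_of_intersecting_cycles
    [Fintype V] [Fintype E]
    (es₁ es₂ : List E) (h₁ : IsCycle s r es₁) (h₂ : IsCycle s r es₂)
    (hdistinct : {e | e ∈ es₁} ≠ {e | e ∈ es₂})
    (hcommon : (cycleVerts s es₁ ∩ cycleVerts s es₂).Nonempty)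
    (W : Submodule F (LeavittPathAlgebra F s r)) (hfd : FiniteDimensional F W)
    (hgen : ∀ x : LeavittPathAlgebra F s r, ∃ n : ℕ, x ∈ powsSum F W n) :
    ∃ c : ℝ, 1 < c ∧ ∃ N : ℕ, ∀ n ≥ N,
      c ^ n ≤ (Module.finrank F (powsSum F W n) : ℝ) := by
  obtain ⟨v, hv₁, hv₂⟩ := hcommon
  obtain ⟨p, hp0, hp, hpn, hpm⟩ := cycle_rotate s r es₁ h₁ v hv₁
  obtain ⟨q, hq0, hq, hqn, hqm⟩ := cycle_rotate s r es₂ h₂ v hv₂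
  have hpq : p ≠ q := by
    rintro rfl
    apply hdistinct
    ext e
    exact (hpm e).symm.trans (hqm e)
  have n1 : ¬ p <+: q := fun h => hpq (no_prefix s r p q v hp0 hp hq hqn h)
  have n2 : ¬ q <+: p := fun h => hpq (no_prefix s r q p v hq0 hq hp hpn h).symm
  refine abstract_growth F W hfd hgen
    (fun b => (cond b (lpath F s r p) (lpath F s r q)) * lvert F s r v)
    (fun b => cond b (lpathStar F s r p) (lpathStar F s r q))
    (lvert F s r v) (lvert_ne_zero F s r v) (lvert_self F s r v) ?_ ?_
  · intro b
    cases b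
    · exact lvert_lpath F s r q v v hq
    · exact lvert_lpath F s r p v v hp
  · intro i j
    cases i <;> cases j
    · simpa using lpathStar_self F s r q v v hq
    · simpa using lpathStar_ne F s r q p v v v hq hp n2 n1
    · simpa using lpathStar_ne F s r p q v v v hp hq n1 n2
    · simpa using lpathStar_self F s r p v v hp

end LeavittSetup
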